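/- arXiv:2102.11116 — 4 statements merged into one kernel-verified Lean document; each statement's English description precedes it below -/
import Mathlib

section
/- Let I be a finite index set, Ξ : I → ℕ, and A : I → ℕ with A_i ≤ Ξ_i for all i, m = ∑_{i∈I} A_i, and m < ∑_{i∈I} Ξ_i. If the propensity matrix is constant, Ω_i = c > 0 for all i ∈ I, then the Wallenius probability Pr(A | Ξ, Ω) = (∏_{i∈I} C(Ξ_i, A_i)) · ∫₀¹ ∏_{i∈I} (1 − z^{Ω_i/S_Ω})^{A_i} dz, with S_Ω = ∑_{i∈I} Ω_i (Ξ_i − A_i), equals the multivariate hypergeometric probability (∏_{i∈I} C(Ξ_i, A_i)) / C(∑_{i∈I} Ξ_i, m). -/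
open MeasureTheory Real Finset

theorem beta_nat_aux (m : ℕ) : ∀ n : ℕ, ∫ u in (0:ℝ)..1, u ^ n * (1 - u) ^ m
    = (n.factorial : ℝ) * m.factorial / (n + m + 1).factorial := by
  induction m with
  | zero =>
    intro n
    have h : ((n:ℝ) + 1) ≠ 0 := by positivity
    have h2 : (n.factorial : ℝ) ≠ 0 := by positivity
    simp [integral_pow, Nat.factorial_succ]
    field_simp
  | succ m ih =>
    intro n
    have e : ∀ u : ℝ, u ^ n * (1 - u) ^ (m + 1)
        = u ^ n * (1 - u) ^ m - u ^ (n + 1) * (1 - u) ^ m := by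
      intro u; ring
    simp_rw [e]
    rw [intervalIntegral.integral_sub
      (Continuous.intervalIntegrable (by fun_prop) _ _)
      (Continuous.intervalIntegrable (by fun_prop) _ _), ih, ih]
    have h1 : n + 1 + m + 1 = (n + m + 1) + 1 := by ring
    have h2 : n + (m + 1) + 1 = (n + m + 1) + 1 := by ring
    rw [h1, h2, Nat.factorial_succ (n + m + 1), Nat.factorial_succ n, Nat.factorial_succ m]
    have h3 : ((n + m + 1).factorial : ℝ) ≠ 0 := by positivity
    have h4 : ((n:ℝ) + m + 1 + 1) ≠ 0 := by positivity
    push_cast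
    field_simp
    ring

theorem wallenius_integral_aux (k m : ℕ) :
    ∫ z in (0:ℝ)..1, (1 - z ^ (1 / ((k + 1 : ℕ) : ℝ))) ^ m
      = 1 / (Nat.choose (k + 1 + m) m : ℝ) := by
  have hcont : Continuous (fun z : ℝ => (1 - z ^ (1 / ((k + 1 : ℕ) : ℝ))) ^ m) := by
    have := Real.continuous_rpow_const (q := 1 / ((k + 1 : ℕ) : ℝ)) (by positivity)
    fun_prop
  have hs := intervalIntegral.integral_comp_mul_deriv (a := 0) (b := 1)
    (f := fun u : ℝ => u ^ (k + 1)) (f' := fun u : ℝ => ((k + 1 : ℕ) : ℝ) * u ^ k)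
    (g := fun z : ℝ => (1 - z ^ (1 / ((k + 1 : ℕ) : ℝ))) ^ m)
    (fun x _ => by simpa using hasDerivAt_pow (k + 1) x)
    (Continuous.continuousOn (by fun_prop)) hcont
  simp only [Function.comp_apply, one_pow, zero_pow (Nat.succ_ne_zero k)] at hs
  rw [← hs]
  have e : ∫ u in (0:ℝ)..1, (1 - (u ^ (k + 1)) ^ (1 / ((k + 1 : ℕ) : ℝ))) ^ m
      * (((k + 1 : ℕ) : ℝ) * u ^ k)
      = ∫ u in (0:ℝ)..1, ((k + 1 : ℕ) : ℝ) * (u ^ k * (1 - u) ^ m) := by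
    apply intervalIntegral.integral_congr
    intro u hu
    rw [Set.uIcc_of_le zero_le_one] at hu
    simp only
    rw [one_div, Real.pow_rpow_inv_natCast hu.1 (Nat.succ_ne_zero k)]
    ring
  rw [e, intervalIntegral.integral_const_mul, beta_nat_aux,
    Nat.cast_choose ℝ (Nat.le_add_left m (k + 1)), Nat.add_sub_cancel, Nat.factorial_succ k,
    show k + 1 + m = k + m + 1 by ring]
  have h3 : ((k + m + 1).factorial : ℝ) ≠ 0 := by positivity
  push_cast
  field_simp

/-- With a constant propensity matrix `Ω i = c > 0`, the Wallenius probability equals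
the multivariate hypergeometric probability. -/
theorem wallenius_constant_propensity_eq_hypergeometric
    {I : Type*} [Fintype I] (Ξ A : I → ℕ) (hA : ∀ i, A i ≤ Ξ i)
    (m : ℕ) (hm : m = ∑ i, A i) (hlt : m < ∑ i, Ξ i)
    (Ω : I → ℝ) (c : ℝ) (hc : 0 < c) (hΩ : ∀ i, Ω i = c) :
    (∏ i, (Nat.choose (Ξ i) (A i) : ℝ)) *
      ∫ z in (0:ℝ)..1,
        ∏ i, (1 - z ^ (Ω i / ∑ j, Ω j * ((Ξ j : ℝ) - (A j : ℝ)))) ^ (A i)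
    = (∏ i, (Nat.choose (Ξ i) (A i) : ℝ)) / (Nat.choose (∑ i, Ξ i) m : ℝ) := by
  have hle : ∑ i, A i ≤ ∑ i, Ξ i := Finset.sum_le_sum fun i _ => hA i
  obtain ⟨k, hk⟩ : ∃ k, ∑ i, Ξ i = k + 1 + m := ⟨∑ i, Ξ i - m - 1, by omega⟩
  have hS : ∑ j, Ω j * ((Ξ j : ℝ) - (A j : ℝ)) = c * ((k + 1 : ℕ) : ℝ) := by
    simp_rw [hΩ]
    rw [← Finset.mul_sum, Finset.sum_sub_distrib, ← Nat.cast_sum, ← Nat.cast_sum, hk, ← hm]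
    push_cast
    ring
  have hq : c / (c * ((k + 1 : ℕ) : ℝ)) = 1 / ((k + 1 : ℕ) : ℝ) := by
    field_simp
  simp_rw [hS, hΩ, hq, Finset.prod_pow_eq_pow_sum]
  rw [← hm, wallenius_integral_aux, hk, mul_one_div]
end

section
/- The Wallenius probabilities define a probability distribution: for a finite index set I, Ξ : I → ℕ, positive propensities Ω : I → ℝ, and a sample size m with 0 ≤ m < ∑_{i∈I} Ξ_i, the sum over all A : I → ℕ with A_i ≤ Ξ_i for all i and ∑_{i∈I} A_i = m of Pr(A | Ξ, Ω) = (∏_{i∈I} C(Ξ_i, A_i)) · ∫₀¹ ∏_{i∈I} (1 − z^{Ω_i/S_Ω})^{A_i} dz equals 1, where S_Ω = ∑_{i∈I} Ω_i (Ξ_i − A_i). -/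
open MeasureTheory Real Finset

noncomputable section WalleniusAux

/-- total remaining propensity -/
def wS {I : Type*} [Fintype I] (Ξ : I → ℕ) (Ω : I → ℝ) (A : I → ℕ) : ℝ :=
  ∑ j, Ω j * ((Ξ j : ℝ) - (A j : ℝ))

def wC {I : Type*} [Fintype I] (Ξ : I → ℕ) (A : I → ℕ) : ℝ :=
  ∏ i, (Nat.choose (Ξ i) (A i) : ℝ)

def wR {I : Type*} [Fintype I] (Ω : I → ℝ) (A : I → ℕ) (t : ℝ) : ℝ :=
  ∏ i, (1 - t ^ (Ω i)) ^ (A i)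

def wP {I : Type*} [Fintype I] (Ξ : I → ℕ) (Ω : I → ℝ) (A : I → ℕ) (t : ℝ) : ℝ :=
  wC Ξ A * (t ^ (wS Ξ Ω A) * wR Ω A t)

def wQ {I : Type*} [Fintype I] (Ξ : I → ℕ) (Ω : I → ℝ) (A : I → ℕ) (t : ℝ) : ℝ :=
  wC Ξ A * (wS Ξ Ω A * t ^ (wS Ξ Ω A - 1) * wR Ω A t)

variable {I : Type*} [Fintype I] [DecidableEq I]

lemma wC_zero (Ξ : I → ℕ) (A : I → ℕ) (h : ¬ ∀ i, A i ≤ Ξ i) : wC Ξ A = 0 := by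
  push Not at h
  obtain ⟨i, hi⟩ := h
  exact Finset.prod_eq_zero (Finset.mem_univ i) (by simp [Nat.choose_eq_zero_of_lt hi])

lemma wS_pos (Ξ : I → ℕ) (Ω : I → ℝ) (hΩ : ∀ i, 0 < Ω i) (A : I → ℕ)
    (h : ∀ i, A i ≤ Ξ i) (hlt : ∑ i, A i < ∑ i, Ξ i) : 0 < wS Ξ Ω A := by
  obtain ⟨i, -, hi⟩ := Finset.exists_lt_of_sum_lt hlt
  refine Finset.sum_pos' (fun j _ => ?_) ⟨i, Finset.mem_univ i, ?_⟩
  · have : (A j : ℝ) ≤ Ξ j := by exact_mod_cast h j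
    exact mul_nonneg (hΩ j).le (by linarith)
  · have : (A i : ℝ) < Ξ i := by exact_mod_cast hi
    exact mul_pos (hΩ i) (by linarith)

lemma wR_cont (Ω : I → ℝ) (hΩ : ∀ i, 0 < Ω i) (A : I → ℕ) : Continuous (wR Ω A) := by
  unfold wR
  refine continuous_finsetProd _ fun i _ => ?_
  exact (continuous_const.sub (Real.continuous_rpow_const (hΩ i).le)).pow _

lemma wR_deriv (Ω : I → ℝ) (A : I → ℕ) {t : ℝ} (ht : 0 < t) :
    HasDerivAt (wR Ω A) (∑ i, (∏ j ∈ univ.erase i, (1 - t ^ (Ω j)) ^ (A j)) *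
      ((A i : ℝ) * (1 - t ^ (Ω i)) ^ (A i - 1) * (-(Ω i * t ^ (Ω i - 1))))) t := by
  unfold wR
  have := HasDerivAt.fun_finsetProd (u := (univ : Finset I)) (x := t)
    (f := fun i (t : ℝ) => (1 - t ^ (Ω i)) ^ (A i))
    (f' := fun i => (A i : ℝ) * (1 - t ^ (Ω i)) ^ (A i - 1) * (-(Ω i * t ^ (Ω i - 1))))
    (fun i _ => by
      have h := (Real.hasDerivAt_rpow_const (x := t) (p := Ω i) (Or.inl ht.ne')).const_sub 1
      exact h.pow _)
  simpa [smul_eq_mul] using this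

/-- the loss term -/
def wL (Ξ : I → ℕ) (Ω : I → ℝ) (A : I → ℕ) (t : ℝ) (i : I) : ℝ :=
  wC Ξ A * (t ^ (wS Ξ Ω A) * ((∏ j ∈ univ.erase i, (1 - t ^ (Ω j)) ^ (A j)) *
      ((A i : ℝ) * (1 - t ^ (Ω i)) ^ (A i - 1) * (Ω i * t ^ (Ω i - 1)))))

lemma wP_deriv (Ξ : I → ℕ) (Ω : I → ℝ) (A : I → ℕ) {t : ℝ} (ht : 0 < t) :
    HasDerivAt (wP Ξ Ω A) (wQ Ξ Ω A t - ∑ i, wL Ξ Ω A t i) t := by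
  have h1 := Real.hasDerivAt_rpow_const (x := t) (p := wS Ξ Ω A) (Or.inl ht.ne')
  have h := (h1.mul (wR_deriv Ω A ht)).const_mul (wC Ξ A)
  refine h.congr_deriv ?_
  unfold wQ wL
  rw [← Finset.mul_sum, ← Finset.mul_sum]
  simp only [mul_neg, Finset.sum_neg_distrib]
  ring

lemma wL_step (Ξ : I → ℕ) (Ω : I → ℝ) (B : I → ℕ) {t : ℝ} (ht : 0 < t) (i : I) :
    wL Ξ Ω (B + Pi.single i 1) t i =
      wC Ξ B * ((Ω i * ((Ξ i : ℝ) - B i)) * t ^ (wS Ξ Ω B - 1) * wR Ω B t) := by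
  have hne : ∀ j ∈ univ.erase i, (B + Pi.single i 1 : I → ℕ) j = B j := by
    intro j hj
    simp [Finset.ne_of_mem_erase hj]
  have hi : (B + Pi.single i 1 : I → ℕ) i = B i + 1 := by simp
  have hS : wS Ξ Ω (B + Pi.single i 1) = wS Ξ Ω B - Ω i := by
    unfold wS
    rw [← Finset.add_sum_erase _ _ (Finset.mem_univ i), ← Finset.add_sum_erase univ (fun j => Ω j * ((Ξ j : ℝ) - (B j : ℝ))) (Finset.mem_univ i), hi,
      Finset.sum_congr rfl (fun j hj => by rw [hne j hj])]
    push_cast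
    ring
  have hR : wR Ω B t = (1 - t ^ (Ω i)) ^ (B i) * ∏ j ∈ univ.erase i, (1 - t ^ (Ω j)) ^ (B j) := by
    unfold wR
    rw [← Finset.mul_prod_erase _ _ (Finset.mem_univ i)]
  have hC : wC Ξ (B + Pi.single i 1) * ((B i : ℝ) + 1) = wC Ξ B * ((Ξ i : ℝ) - B i) := by
    unfold wC
    rw [← Finset.mul_prod_erase _ _ (Finset.mem_univ i), ← Finset.mul_prod_erase univ (fun j => ((Ξ j).choose (B j) : ℝ)) (Finset.mem_univ i), hi,
      Finset.prod_congr rfl (fun j hj => by rw [hne j hj])]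
    have : ((Ξ i).choose (B i + 1) : ℝ) * ((B i : ℝ) + 1)
        = ((Ξ i).choose (B i) : ℝ) * ((Ξ i : ℝ) - B i) := by
      rcases le_or_gt (B i) (Ξ i) with h | h
      · have := Nat.choose_succ_right_eq (Ξ i) (B i)
        rw [← Nat.cast_sub h]
        exact_mod_cast this
      · simp [Nat.choose_eq_zero_of_lt h, Nat.choose_eq_zero_of_lt (h.trans (Nat.lt_succ_self _))]
    linear_combination (∏ j ∈ univ.erase i, ((Ξ j).choose (B j) : ℝ)) * this
  have ht2 : t ^ (wS Ξ Ω B - 1) = t ^ (wS Ξ Ω B - Ω i) * t ^ (Ω i - 1) := by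
    rw [← Real.rpow_add ht]; congr 1; ring
  unfold wL
  rw [hS, hR, ht2, hi, Finset.prod_congr rfl (fun j hj => by rw [hne j hj])]
  push_cast
  linear_combination (t ^ (wS Ξ Ω B - Ω i) * ((∏ j ∈ univ.erase i, (1 - t ^ (Ω j)) ^ (B j)) *
      ((1 - t ^ (Ω i)) ^ (B i) * (Ω i * t ^ (Ω i - 1))))) * hC

lemma wL_sum (Ξ : I → ℕ) (Ω : I → ℝ) (m : ℕ) {t : ℝ} (ht : 0 < t) :
    ∑ A ∈ piAntidiag univ (m + 1), ∑ i, wL Ξ Ω A t i = ∑ B ∈ piAntidiag univ m, wQ Ξ Ω B t := by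
  have hQ : ∀ B, wQ Ξ Ω B t = ∑ i, wL Ξ Ω (B + Pi.single i 1) t i := by
    intro B
    simp only [wL_step Ξ Ω B ht]
    rw [← Finset.mul_sum, ← Finset.sum_mul, ← Finset.sum_mul]
    rfl
  simp only [hQ]
  rw [Finset.sum_comm, Finset.sum_comm (s := piAntidiag univ m)]
  refine Finset.sum_congr rfl fun i _ => ?_
  symm
  refine Finset.sum_of_injOn (fun B => B + Pi.single i 1) ?_ ?_ ?_ ?_
  · intro a _ b _ h
    exact add_right_cancel h
  · intro B hB
    simp only [Finset.mem_coe, mem_piAntidiag] at hB ⊢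
    refine ⟨?_, by simp⟩
    simp [Finset.sum_add_distrib, hB.1]
  · intro A hA hn
    have : A i = 0 := by
      by_contra h0
      apply hn
      have hle : Pi.single i 1 ≤ A := by
        intro j
        by_cases hj : j = i
        · subst hj; simp; omega
        · simp [hj]
      refine ⟨A - Pi.single i 1, ?_, tsub_add_cancel_of_le hle⟩
      simp only [Finset.mem_coe, mem_piAntidiag] at hA ⊢
      refine ⟨?_, by simp⟩
      have h2 : ∑ j, ((A - Pi.single i 1) + Pi.single i 1 : I → ℕ) j = m + 1 := by
        rw [tsub_add_cancel_of_le hle]; exact hA.1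
      simp only [Pi.add_apply, Finset.sum_add_distrib] at h2
      simp at h2
      simpa using h2
    simp [wL, this]
  · intro B _
    rfl

lemma wF_deriv (Ξ : I → ℕ) (Ω : I → ℝ) (m : ℕ) {t : ℝ} (ht : 0 < t) :
    HasDerivAt (fun t => ∑ k ∈ range (m + 1), ∑ A ∈ piAntidiag univ k, wP Ξ Ω A t)
      (∑ A ∈ piAntidiag univ m, wQ Ξ Ω A t) t := by
  have hd : ∀ k, HasDerivAt (fun t => ∑ A ∈ piAntidiag univ k, wP Ξ Ω A t)
      (∑ A ∈ piAntidiag univ k, (wQ Ξ Ω A t - ∑ i, wL Ξ Ω A t i)) t := fun k =>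
    HasDerivAt.fun_sum fun A _ => wP_deriv Ξ Ω A ht
  induction m with
  | zero =>
    simp only [zero_add, Finset.sum_range_one]
    refine (hd 0).congr_deriv ?_
    simp [wL]
  | succ m ih =>
    simp only [Finset.sum_range_succ _ (m + 1)]
    refine (ih.add (hd (m + 1))).congr_deriv ?_
    rw [Finset.sum_sub_distrib, wL_sum Ξ Ω m ht]
    ring

lemma wP_cont (Ξ : I → ℕ) (Ω : I → ℝ) (hΩ : ∀ i, 0 < Ω i) (A : I → ℕ)
    (hlt : ∑ i, A i < ∑ i, Ξ i) : Continuous (wP Ξ Ω A) := by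
  unfold wP
  by_cases h : ∀ i, A i ≤ Ξ i
  · exact continuous_const.mul ((Real.continuous_rpow_const (wS_pos Ξ Ω hΩ A h hlt).le).mul
      (wR_cont Ω hΩ A))
  · simp only [wC_zero Ξ A h, zero_mul]
    exact continuous_const

lemma wQ_int (Ξ : I → ℕ) (Ω : I → ℝ) (hΩ : ∀ i, 0 < Ω i) (A : I → ℕ)
    (hlt : ∑ i, A i < ∑ i, Ξ i) : IntervalIntegrable (wQ Ξ Ω A) volume 0 1 := by
  unfold wQ
  by_cases h : ∀ i, A i ≤ Ξ i
  · have hS := wS_pos Ξ Ω hΩ A h hlt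
    refine IntervalIntegrable.const_mul ?_ _
    refine IntervalIntegrable.mul_continuousOn ?_ (wR_cont Ω hΩ A).continuousOn
    exact (intervalIntegral.intervalIntegrable_rpow' (by linarith)).const_mul _
  · simp only [wC_zero Ξ A h, zero_mul]
    exact intervalIntegrable_const

lemma wQ_total (Ξ : I → ℕ) (Ω : I → ℝ) (hΩ : ∀ i, 0 < Ω i) (m : ℕ) (hm : m < ∑ i, Ξ i) :
    ∑ A ∈ piAntidiag univ m, ∫ t in (0:ℝ)..1, wQ Ξ Ω A t = 1 := by
  have hs : ∀ k, ∀ A ∈ (piAntidiag univ k : Finset (I → ℕ)), ∑ i, A i = k := fun k A hA =>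
    (mem_piAntidiag.1 hA).1
  rw [← intervalIntegral.integral_finsetSum
    (fun A hA => wQ_int Ξ Ω hΩ A (by rw [hs m A hA]; exact hm))]
  rw [intervalIntegral.integral_eq_sub_of_hasDerivAt_of_le zero_le_one
    (f := fun t => ∑ k ∈ range (m + 1), ∑ A ∈ piAntidiag univ k, wP Ξ Ω A t)
    ?_ (fun t ht => wF_deriv Ξ Ω m ht.1) ?_]
  · have h0 : ∑ k ∈ range (m + 1), ∑ A ∈ piAntidiag univ k, wP Ξ Ω A 0 = 0 := by
      refine Finset.sum_eq_zero fun k hk => Finset.sum_eq_zero fun A hA => ?_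
      have hk' := Finset.mem_range.1 hk
      by_cases h : ∀ i, A i ≤ Ξ i
      · have := wS_pos Ξ Ω hΩ A h (by rw [hs k A hA]; omega)
        simp [wP, Real.zero_rpow this.ne']
      · simp [wP, wC_zero Ξ A h]
    have h1 : ∑ k ∈ range (m + 1), ∑ A ∈ piAntidiag univ k, wP Ξ Ω A 1 = 1 := by
      rw [Finset.sum_eq_single 0]
      · simp [wP, wC, wR]
      · intro k _ hk0
        refine Finset.sum_eq_zero fun A hA => ?_
        have : ∃ i, A i ≠ 0 := by
          by_contra! hc
          apply hk0
          rw [← hs k A hA]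
          simp [hc]
        obtain ⟨i, hi⟩ := this
        have : wR Ω A 1 = 0 := Finset.prod_eq_zero (Finset.mem_univ i) (by simp [hi])
        simp [wP, this]
      · simp
    rw [h0, h1, sub_zero]
  · refine Continuous.continuousOn ?_
    refine continuous_finsetSum _ fun k hk => continuous_finsetSum _ fun A hA => ?_
    have hk' := Finset.mem_range.1 hk
    exact wP_cont Ξ Ω hΩ A (by rw [hs k A hA]; omega)
  · have := IntervalIntegrable.sum (piAntidiag univ m) (f := fun A => wQ Ξ Ω A)
      (fun A hA => wQ_int Ξ Ω hΩ A (by rw [hs m A hA]; exact hm))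
    have e : (fun t => ∑ A ∈ piAntidiag univ m, wQ Ξ Ω A t)
        = ∑ A ∈ piAntidiag univ m, wQ Ξ Ω A := by
      ext t
      simp
    rw [e]
    exact this

lemma w_subst (Ω : I → ℝ) (A : I → ℕ) {S : ℝ} (hS : 0 < S) :
    ∫ z in (0:ℝ)..1, ∏ i, (1 - z ^ (Ω i / S)) ^ (A i) =
      ∫ t in (0:ℝ)..1, S * t ^ (S - 1) * wR Ω A t := by
  rw [intervalIntegral.integral_of_le zero_le_one, intervalIntegral.integral_of_le zero_le_one]
  set g : ℝ → ℝ := fun z => ∏ i, (1 - z ^ (Ω i / S)) ^ (A i) with hg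
  have key := integral_comp_rpow_Ioi (Set.indicator (Set.Iic 1) g) hS.ne'
  have e : Set.Ioc (0:ℝ) 1 = Set.Ioi 0 ∩ Set.Iic 1 := by ext; simp
  rw [e, ← setIntegral_indicator measurableSet_Iic, ← setIntegral_indicator measurableSet_Iic,
    ← key]
  refine setIntegral_congr_fun measurableSet_Ioi fun t ht => ?_
  have ht' : (0:ℝ) < t := ht
  simp only [smul_eq_mul, abs_of_pos hS, Set.indicator, Set.mem_Iic]
  have hiff : t ^ S ≤ 1 ↔ t ≤ 1 := by
    rw [← Real.rpow_le_rpow_iff ht'.le zero_le_one hS, Real.one_rpow]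
  by_cases h : t ≤ 1
  · rw [if_pos (hiff.2 h), if_pos h]
    congr 1
    simp only [hg, wR]
    refine Finset.prod_congr rfl fun i _ => ?_
    rw [← Real.rpow_mul ht'.le, mul_div_cancel₀ _ hS.ne']
  · rw [if_neg (fun h' => h (hiff.1 h')), if_neg h, mul_zero]

end WalleniusAux

/-- The Wallenius (gHypEG) probabilities sum to one over all adjacency assignments
`A : I → ℕ` with `A i ≤ Ξ i` and `∑ i, A i = m`, provided `m < ∑ i, Ξ i` and all
propensities are positive. -/
theorem wallenius_sums_to_one
    {I : Type*} [Fintype I] [DecidableEq I] (Ξ : I → ℕ) (Ω : I → ℝ)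
    (hΩ : ∀ i, 0 < Ω i) (m : ℕ) (hm : m < ∑ i, Ξ i) :
    (∑ A ∈ (Fintype.piFinset fun i => Finset.range (Ξ i + 1)).filter
        (fun A => ∑ i, A i = m),
      (∏ i, (Nat.choose (Ξ i) (A i) : ℝ)) *
        ∫ z in (0:ℝ)..1,
          ∏ i, (1 - z ^ (Ω i / ∑ j, Ω j * ((Ξ j : ℝ) - (A j : ℝ)))) ^ (A i)) = 1 := by
  refine Eq.trans ?_ (wQ_total Ξ Ω hΩ m hm)
  have hsub : (Fintype.piFinset fun i => Finset.range (Ξ i + 1)).filter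
        (fun A => ∑ i, A i = m) ⊆ piAntidiag univ m := by
    intro A hA
    rw [mem_piAntidiag]
    exact ⟨(Finset.mem_filter.1 hA).2, by simp⟩
  rw [← Finset.sum_subset hsub]
  · refine Finset.sum_congr rfl fun A hA => ?_
    obtain ⟨h1, h2⟩ := Finset.mem_filter.1 hA
    have hle : ∀ i, A i ≤ Ξ i := fun i =>
      Nat.lt_succ_iff.1 (Finset.mem_range.1 (Fintype.mem_piFinset.1 h1 i))
    have hS := wS_pos Ξ Ω hΩ A hle (by rw [h2]; exact hm)
    have := w_subst Ω A hS
    unfold wQ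
    rw [intervalIntegral.integral_const_mul, ← this]
    rfl
  · intro A hA hn
    have : ¬ ∀ i, A i ≤ Ξ i := by
      intro h
      apply hn
      rw [Finset.mem_filter, Fintype.mem_piFinset]
      exact ⟨fun i => Finset.mem_range.2 (Nat.lt_succ_iff.2 (h i)), (mem_piAntidiag.1 hA).1⟩
    simp [wQ, wC_zero Ξ A this]
end

section
/- The hypergeometric configuration model preserves the degree sequence in expectation: let V be a finite vertex set, k^out, k^in : V → ℕ with ∑_{v∈V} k^out_v = ∑_{v∈V} k^in_v = m and m ≥ 1, and set Ξ_{ij} = k^out_i · k^in_j for all ordered pairs (i,j) ∈ V × V. Then under the multivariate hypergeometric distribution with category sizes Ξ and sample size m, for every vertex v the expected out-degree ∑_{j∈V} E[A_{vj}] equals k^out_v, and the expected in-degree ∑_{i∈V} E[A_{iv}] equals k^in_v. -/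
open Finset

open Polynomial in
lemma hyp_poly_full (n : ℕ) :
    ∑ a ∈ range (n + 1), C (n.choose a) * (X : ℕ[X]) ^ a = (X + 1) ^ n := by
  rw [add_pow]
  refine sum_congr rfl fun a _ => ?_
  simp [mul_comm]

open Polynomial in
lemma hyp_poly_size (n : ℕ) :
    ∑ a ∈ range (n + 1), C (a * n.choose a) * (X : ℕ[X]) ^ a
      = C n * X * (X + 1) ^ (n - 1) := by
  cases n with
  | zero => simp
  | succ n =>
    rw [sum_range_succ', Nat.add_sub_cancel, ← hyp_poly_full, mul_sum]
    simp only [zero_mul, C_0, add_zero]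
    refine sum_congr rfl fun a _ => ?_
    rw [mul_comm (a + 1), ← Nat.add_one_mul_choose_eq, C_mul]
    ring

open Polynomial in
lemma hyp_coeff {ι : Type*} [Fintype ι] [DecidableEq ι] (N : ι → ℕ) (c : ι → ℕ → ℕ) (m : ℕ) :
    (∏ p, ∑ a ∈ range (N p + 1), C (c p a) * (X : ℕ[X]) ^ a).coeff m
      = ∑ A ∈ (Fintype.piFinset fun p => range (N p + 1)).filter (fun A => ∑ p, A p = m),
          ∏ p, c p (A p) := by
  rw [prod_univ_sum, finset_sum_coeff, sum_filter]
  refine sum_congr rfl fun A _ => ?_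
  rw [prod_mul_distrib, prod_pow_eq_pow_sum, ← map_prod, coeff_C_mul, coeff_X_pow]
  simp [eq_comm]

open Polynomial in
lemma hyp_mean {ι : Type*} [Fintype ι] [DecidableEq ι] (N : ι → ℕ) (q : ι) (m : ℕ) :
    ∑ A ∈ (Fintype.piFinset fun p => range (N p + 1)).filter (fun A => ∑ p, A p = m + 1),
        A q * ∏ p, (N p).choose (A p)
      = N q * (∑ p, N p - 1).choose m := by
  have h := hyp_coeff N (fun p a => (if p = q then a else 1) * (N p).choose a) (m + 1)
  simp only [prod_mul_distrib, prod_ite_eq', mem_univ, if_true] at h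
  rw [← h, ← mul_prod_erase univ _ (mem_univ q)]
  have h2 : ∏ x ∈ univ.erase q, ∑ a ∈ range (N x + 1),
      C ((if x = q then a else 1) * (N x).choose a) * (X : ℕ[X]) ^ a
      = (X + 1) ^ (∑ x ∈ univ.erase q, N x) := by
    rw [← prod_pow_eq_pow_sum]
    refine prod_congr rfl fun x hx => ?_
    simp only [if_neg (ne_of_mem_erase hx), one_mul]
    exact hyp_poly_full _
  rw [h2]
  simp only [if_true]
  rw [hyp_poly_size, ← add_sum_erase univ N (mem_univ q)]
  rcases Nat.eq_zero_or_pos (N q) with h0 | h0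
  · simp [h0]
  · rw [mul_assoc, ← pow_add, mul_assoc, coeff_C_mul, coeff_X_mul, coeff_X_add_one_pow,
      Nat.sub_add_comm h0]
    simp

lemma hyp_mean_real {ι : Type*} [Fintype ι] [DecidableEq ι] (N : ι → ℕ) (q : ι) (m : ℕ)
    (hm : 1 ≤ m) (hN : ∑ p, N p = m * m) :
    ∑ A ∈ (Fintype.piFinset fun p => range (N p + 1)).filter (fun A => ∑ p, A p = m),
        (A q : ℝ) * ((∏ p, ((N p).choose (A p) : ℝ)) / ((∑ p, N p).choose m : ℝ))
      = N q / m := by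
  obtain ⟨k, rfl⟩ : ∃ k, m = k + 1 := ⟨m - 1, by omega⟩
  have h := hyp_mean N q k
  have h' := congrArg (Nat.cast : ℕ → ℝ) h
  push_cast at h'
  simp only [← mul_div_assoc]
  rw [← sum_div, h', hN]
  obtain ⟨M, hM⟩ : ∃ M, (k + 1) * (k + 1) = M + 1 := ⟨k * k + 2 * k, by ring⟩
  have h3 := Nat.add_one_mul_choose_eq M k
  have hpos : 0 < (M + 1).choose (k + 1) := Nat.choose_pos (by nlinarith)
  rw [← hM, mul_comm (Nat.choose _ _), mul_assoc] at h3
  have h4 := Nat.eq_of_mul_eq_mul_left (Nat.succ_pos k) h3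
  rw [hM] at h4 ⊢
  have h5 : ((k + 1 : ℕ) : ℝ) * (M.choose k : ℝ) = ((M + 1).choose (k + 1) : ℝ) := by
    exact_mod_cast h4
  have h6 : ((M + 1).choose (k + 1) : ℝ) ≠ 0 := by exact_mod_cast hpos.ne'
  have h7 : ((k + 1 : ℕ) : ℝ) ≠ 0 := by positivity
  rw [Nat.add_sub_cancel, div_eq_div_iff h6 h7, ← h5]
  ring

/-- The hypergeometric configuration model, with `Ξ (i,j) = k^out i · k^in j`,
preserves the degree sequence in expectation: for every vertex `v`, the expected
out-degree equals `k^out v` and the expected in-degree equals `k^in v`. -/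
theorem configuration_model_preserves_degrees
    {V : Type*} [Fintype V] [DecidableEq V] (kout kin : V → ℕ) (m : ℕ)
    (hout : ∑ v, kout v = m) (hin : ∑ v, kin v = m) (hm : 1 ≤ m) :
    ∀ v : V,
      (∑ j : V,
        ∑ A ∈ (Fintype.piFinset fun p : V × V =>
            Finset.range (kout p.1 * kin p.2 + 1)).filter
            (fun A => ∑ p : V × V, A p = m),
          (A (v, j) : ℝ) *
            ((∏ p : V × V, (Nat.choose (kout p.1 * kin p.2) (A p) : ℝ)) /
              (Nat.choose (∑ p : V × V, kout p.1 * kin p.2) m : ℝ)))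
        = (kout v : ℝ) ∧
      (∑ i : V,
        ∑ A ∈ (Fintype.piFinset fun p : V × V =>
            Finset.range (kout p.1 * kin p.2 + 1)).filter
            (fun A => ∑ p : V × V, A p = m),
          (A (i, v) : ℝ) *
            ((∏ p : V × V, (Nat.choose (kout p.1 * kin p.2) (A p) : ℝ)) /
              (Nat.choose (∑ p : V × V, kout p.1 * kin p.2) m : ℝ)))
        = (kin v : ℝ) := by
  intro v
  have hN : ∑ p : V × V, kout p.1 * kin p.2 = m * m := by
    rw [Fintype.sum_prod_type, ← Finset.sum_mul_sum, hout, hin]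
  have hm0 : (m : ℝ) ≠ 0 := by
    have : m ≠ 0 := by omega
    exact_mod_cast this
  have hout' : ∑ v, (kout v : ℝ) = m := by exact_mod_cast hout
  have hin' : ∑ v, (kin v : ℝ) = m := by exact_mod_cast hin
  have key := fun q : V × V => hyp_mean_real (fun p : V × V => kout p.1 * kin p.2) q m hm hN
  constructor
  · rw [Finset.sum_congr rfl fun j _ => key (v, j), ← Finset.sum_div]
    push_cast
    rw [← Finset.mul_sum, hin', mul_div_cancel_right₀ _ hm0]
  · rw [Finset.sum_congr rfl fun i _ => key (i, v), ← Finset.sum_div]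
    push_cast
    rw [← Finset.sum_mul, hout', mul_div_cancel_left₀ _ hm0]
end

section
/- The multivariate hypergeometric distribution converges to the multinomial distribution as the category sizes grow proportionally: let I be a finite index set, q : I → ℕ with q_i ≥ 1 for all i and Q = ∑_{i∈I} q_i, and let A : I → ℕ with ∑_{i∈I} A_i = m. Then as c → ∞ (over the naturals), (∏_{i∈I} C(c·q_i, A_i)) / C(c·Q, m) converges to (m! / ∏_{i∈I} A_i!) · ∏_{i∈I} (q_i / Q)^{A_i}. -/
open Finset Filter

lemma choose_scaled_tendsto (q k : ℕ) (h : 1 ≤ q ∨ k = 0) :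
    Tendsto (fun c : ℕ => (Nat.choose (c * q) k : ℝ) / (c : ℝ) ^ k) atTop
      (nhds ((q : ℝ) ^ k / (k.factorial : ℝ))) := by
  rcases h with h | rfl
  · have h0 : (q : ℝ) ≠ 0 := by positivity
    have hr : Tendsto (fun n : ℕ => (n : ℝ) * ((q : ℝ) / n)) atTop (nhds (q : ℝ)) := by
      refine tendsto_const_nhds.congr' ?_
      filter_upwards [eventually_gt_atTop 0] with n hn
      have : (n : ℝ) ≠ 0 := by positivity
      field_simp
    have h1 := ProbabilityTheory.tendsto_choose_mul_pow_atTop k hr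
    have h2 : Tendsto (fun c : ℕ => c * q) atTop atTop :=
      tendsto_id.atTop_mul_const' (by omega)
    refine (h1.comp h2).congr' ?_
    filter_upwards [eventually_gt_atTop 0] with c hc
    have : (c : ℝ) ≠ 0 := by positivity
    have e : (q : ℝ) / ((c * q : ℕ) : ℝ) = 1 / c := by
      push_cast
      field_simp
    simp only [Function.comp, e]
    rw [div_pow, one_pow, mul_one_div]
  · simp

/-- The multivariate hypergeometric distribution with proportionally growing category
sizes `c·q i` converges to the multinomial distribution with probabilities `q i / Q`. -/
theorem hypergeometric_tendsto_multinomial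
    {I : Type*} [Fintype I] (q : I → ℕ) (hq : ∀ i, 1 ≤ q i)
    (A : I → ℕ) (m : ℕ) (hA : ∑ i, A i = m) :
    Tendsto
      (fun c : ℕ =>
        (∏ i, (Nat.choose (c * q i) (A i) : ℝ)) /
          (Nat.choose (c * ∑ i, q i) m : ℝ))
      atTop
      (nhds (((m.factorial : ℝ) / ∏ i, ((A i).factorial : ℝ)) *
        ∏ i, ((q i : ℝ) / ((∑ i, q i : ℕ) : ℝ)) ^ (A i))) := by
  have hQ : 1 ≤ ∑ i, q i ∨ m = 0 := by
    rcases isEmpty_or_nonempty I with hI | ⟨⟨j⟩⟩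
    · right; rw [← hA]; simp
    · left
      exact (hq j).trans (Finset.single_le_sum (fun i _ => Nat.zero_le (q i)) (mem_univ j))
  have hne : ((∑ i, q i : ℕ) : ℝ) ^ m ≠ 0 := by
    rcases hQ with h | h
    · have : (0 : ℝ) < ((∑ i, q i : ℕ) : ℝ) := by exact_mod_cast h
      positivity
    · simp [h]
  have hm : (m.factorial : ℝ) ≠ 0 := by positivity
  have h1 := tendsto_finsetProd (univ : Finset I)
    (fun i _ => choose_scaled_tendsto (q i) (A i) (Or.inl (hq i)))
  have h2 := h1.div (choose_scaled_tendsto (∑ i, q i) m hQ) (div_ne_zero hne hm)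
  have key : (∏ i, (q i : ℝ) ^ A i / ((A i).factorial : ℝ)) /
      (((∑ i, q i : ℕ) : ℝ) ^ m / (m.factorial : ℝ)) =
      ((m.factorial : ℝ) / ∏ i, ((A i).factorial : ℝ)) *
        ∏ i, ((q i : ℝ) / ((∑ i, q i : ℕ) : ℝ)) ^ (A i) := by
    simp only [div_pow, Finset.prod_div_distrib, Finset.prod_pow_eq_pow_sum, hA]
    rw [div_div_div_eq, div_mul_div_comm, mul_comm (m.factorial : ℝ)]
  rw [key] at h2
  refine h2.congr' ?_
  filter_upwards [eventually_gt_atTop 0] with c hc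
  have hc' : (c : ℝ) ^ m ≠ 0 := by positivity
  simp only [Pi.div_apply, Finset.prod_div_distrib, Finset.prod_pow_eq_pow_sum, hA]
  exact div_div_div_cancel_right₀ hc' _ _
end
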